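/- Let G be an amenable group and let X be an irreducible algebraic variety over an algebraically closed field K. Let A := X(K) denote the set of K-points of X. Then every surjective algebraic cellular automaton τ : A^G → A^G over (G,X,K) is (*)-pre-injective. -/

import Mathlib

open AlgebraicGeometry CategoryTheory CategoryTheory.Limits Filter Topology
open scoped ENNReal NNReal

noncomputable section

namespace GOE

/-! ## Følner nets and amenability -/

/-- A (right) Følner net for a group `G`: a net of nonempty finite subsets `F i ⊆ G`,
indexed by a directed nonempty preorder, such that `|F i \ F i g| / |F i| → 0` for every
`g ∈ G`. -/
structure FolnerNet (G : Type) [Group G] where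
  ι : Type
  [pre : Preorder ι]
  [ne : Nonempty ι]
  [dir : IsDirected ι (· ≤ ·)]
  F : ι → Finset G
  nonempty : ∀ i, (F i).Nonempty
  folner : ∀ g : G,
    Filter.Tendsto
      (fun i => ((((F i : Set G) \ ((· * g) '' (F i : Set G))).ncard : ℝ) / ((F i).card : ℝ)))
      Filter.atTop (nhds 0)

attribute [instance] FolnerNet.pre FolnerNet.ne FolnerNet.dir

/-- A group is amenable if it admits a Følner net. -/
def Amenable (G : Type) [Group G] : Prop := Nonempty (FolnerNet G)

/-! ## Constructible subsets of a topological space -/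

/-- A subset of a topological space is constructible if it is a finite union of
locally closed subsets. -/
def IsConstr {X : Type} [TopologicalSpace X] (C : Set X) : Prop :=
  ∃ (n : ℕ) (U Z : Fin n → Set X), (∀ i, IsOpen (U i)) ∧ (∀ i, IsClosed (Z i)) ∧
    C = ⋃ i, U i ∩ Z i

/-- Conversion of a Krull dimension (an element of `WithBot ℕ∞`) to an extended real. -/
def dimE (d : WithBot ℕ∞) : EReal :=
  WithBot.recBotCoe ⊥ (fun n : ℕ∞ => ((n : ℝ≥0∞) : EReal)) d

/-! ## Varieties over a field and their points -/

variable (K : Type) [Field K]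

/-- The spectrum of the field `K`, as a scheme. -/
abbrev SpecK : Scheme := Spec (CommRingCat.of K)

/-- The unique point of `Spec K`. -/
def specPt : SpecK K := (⟨⊥, Ideal.bot_prime⟩ : PrimeSpectrum K)

instance : HasFiniteProducts (Over (SpecK K)) :=
  CategoryTheory.Over.ConstructProducts.over_finiteProducts_of_finiteWidePullbacks

/-- The set of `K`-points of a `K`-scheme, i.e. sections of the structure morphism,
i.e. morphisms `Spec K ⟶ X` over `Spec K`. -/
abbrev Pt (W : Over (SpecK K)) : Type := Over.mk (𝟙 (SpecK K)) ⟶ W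

/-- The image in (the underlying space of) `W` of a `K`-point of `W`. -/
def ev {W : Over (SpecK K)} (a : Pt K W) : W.left := a.left.base (specPt K)

/-- The fibered power `X^Ω` over `Spec K` of a `K`-scheme `X`, for a finite index set `Ω`. -/
def pow (V : Over (SpecK K)) (Ω : Type) [Finite Ω] : Over (SpecK K) :=
  ∏ᶜ (fun _ : Ω => V)

/-- The canonical identification of families of `K`-points indexed by `Ω` with
`K`-points of the fibered power `X^Ω`. -/
def ptPow (V : Over (SpecK K)) (Ω : Type) [Finite Ω] (a : Ω → Pt K V) :
    Pt K (pow K V Ω) := Pi.lift a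

variable (V : Over (SpecK K))

/-- The Krull dimension of (the underlying space of) a `K`-scheme. -/
def vdim : WithBot ℕ∞ := topologicalKrullDim V.left

/-- The Zariski topology on `A^Ω` (`A` the set of `K`-points of `X`), induced from the
Zariski topology of the fibered power `X^Ω` via the identification of `A^Ω` with a
subset (the set of closed points, for `K` algebraically closed) of `X^Ω`. -/
def cfgTop (Ω : Type) [Finite Ω] : TopologicalSpace (Ω → Pt K V) :=
  TopologicalSpace.induced (fun u => ev K (ptPow K V Ω u)) inferInstance

/-- The Krull dimension of a subset `D ⊆ A^Ω` for the Zariski topology. -/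
def cfgDim (Ω : Type) [Finite Ω] (D : Set (Ω → Pt K V)) : WithBot ℕ∞ :=
  letI := cfgTop K V Ω
  topologicalKrullDim D

/-- `D ⊆ A^Ω` is closed for the Zariski topology. -/
def cfgClosed (Ω : Type) [Finite Ω] (D : Set (Ω → Pt K V)) : Prop :=
  letI := cfgTop K V Ω
  IsClosed D

/-- `D ⊆ A^Ω` is constructible for the Zariski topology. -/
def cfgConstr (Ω : Type) [Finite Ω] (D : Set (Ω → Pt K V)) : Prop :=
  letI := cfgTop K V Ω
  IsConstr D

/-! ## Configurations, restrictions, cylinders -/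

variable {G : Type} [Group G]

/-- The restriction `Γ_Ω ⊆ A^Ω` of a set of configurations `Γ ⊆ A^G`. -/
def restr (Γ : Set (G → Pt K V)) (Ω : Finset G) : Set (↥Ω → Pt K V) :=
  (fun c (ω : ↥Ω) => c ω) '' Γ

/-- The cylinder `D_p ⊆ A^G`: configurations restricting to an element of `D` on `Ω` and
to `p` on `G ∖ Ω`. -/
def cyl (Ω : Finset G) (D : Set (↥Ω → Pt K V)) (p : {g : G // g ∉ Ω} → Pt K V) :
    Set (G → Pt K V) :=
  {c | (fun ω : ↥Ω => c ω) ∈ D ∧ ∀ (g : G) (h : g ∉ Ω), c g = p ⟨g, h⟩}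

/-- Algebraic mean dimension of `Γ ⊆ A^G` with respect to a Følner net. -/
def mdim (𝓕 : FolnerNet G) (Γ : Set (G → Pt K V)) : EReal :=
  Filter.limsup
    (fun i => dimE (cfgDim K V ↥(𝓕.F i) (restr K V Γ (𝓕.F i))) *
      ((((𝓕.F i).card : ℝ)⁻¹ : ℝ) : EReal))
    Filter.atTop

/-! ## Cellular automata -/

/-- `τ : A^G → A^G` is an algebraic cellular automaton over `(G, X, K)`: it admits a finite
memory set `M ⊆ G` whose associated local defining map `A^M → A` is induced by a morphism
of `K`-schemes `f : X^M → X`. -/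
def IsAlgCA (τ : (G → Pt K V) → (G → Pt K V)) : Prop :=
  ∃ (M : Finset G) (f : pow K V ↥M ⟶ V),
    ∀ (x : G → Pt K V) (g : G),
      τ x g = ptPow K V ↥M (fun m => x (g * (m : G))) ≫ f

/-- Pre-injectivity: configurations that are almost equal and have the same image are equal. -/
def PreInjective (τ : (G → Pt K V) → (G → Pt K V)) : Prop :=
  ∀ c₁ c₂ : G → Pt K V, {g : G | c₁ g ≠ c₂ g}.Finite → τ c₁ = τ c₂ → c₁ = c₂

/-- `(*)`-pre-injectivity: there exist no finite subset `Ω ⊆ G` and Zariski-closed proper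
subset `H ⊊ A^Ω` such that `τ((A^Ω)_p) = τ(H_p)` for all `p ∈ A^{G∖Ω}`. -/
def StarPreInjective (τ : (G → Pt K V) → (G → Pt K V)) : Prop :=
  ¬ ∃ (Ω : Finset G) (H : Set (↥Ω → Pt K V)), cfgClosed K V ↥Ω H ∧ H ≠ Set.univ ∧
      ∀ p : {g : G // g ∉ Ω} → Pt K V,
        τ '' cyl K V Ω Set.univ p = τ '' cyl K V Ω H p

/-- `(**)`-pre-injectivity: there is no finite subset `Ω ⊆ G` such that, for every
`p ∈ A^{G∖Ω}`, the finite-support set `τ((A^Ω)_p)` (written as some `R_s`) satisfies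
`dim(R) < dim(A^Ω)`. -/
def StarStarPreInjective (τ : (G → Pt K V) → (G → Pt K V)) : Prop :=
  ¬ ∃ Ω : Finset G, ∀ p : {g : G // g ∉ Ω} → Pt K V,
      ∃ (Λ : Finset G) (R : Set (↥Λ → Pt K V)) (s : {g : G // g ∉ Λ} → Pt K V),
        τ '' cyl K V Ω Set.univ p = cyl K V Λ R s ∧
        cfgDim K V ↥Λ R < cfgDim K V ↥Ω (Set.univ : Set (↥Ω → Pt K V))

/-- `Γ ⊆ A^G` is closed for the prodiscrete topology on `A^G`. -/
def ProdiscreteClosed {A : Type} (Γ : Set (G → A)) : Prop :=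
  letI : TopologicalSpace A := ⊥
  IsClosed Γ

/-- `Γ ⊆ A^G` is invariant under the shift action of `G`. -/
def ShiftInvariant {A : Type} (Γ : Set (G → A)) : Prop :=
  ∀ (g : G), ∀ c ∈ Γ, (fun h : G => c (g⁻¹ * h)) ∈ Γ

/-- An `(E,E')`-tiling of `G`. -/
def IsTiling (E E' : Finset G) (T : Set G) : Prop :=
  (∀ g ∈ T, ∀ h ∈ T, g ≠ h →
    Disjoint ((g * ·) '' (E : Set G)) ((h * ·) '' (E : Set G))) ∧
  ∀ x : G, ∃ g ∈ T, x ∈ (g * ·) '' (E' : Set G)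


/-! ## Transcendence rank of subsets of a field extension -/

section TranscendenceRank

variable (k : Type*) [Field k] {L L' : Type*} [Field L] [Algebra k L] [Field L'] [Algebra k L']

/-- The rank of a subset of `L` in the algebraic matroid of `L / k`. -/
def trRank (S : Set L) : ℕ∞ := (AlgebraicIndependent.matroid k L).eRk S

lemma trRank_mono {S T : Set L} (h : S ⊆ T) : trRank k S ≤ trRank k T :=
  Matroid.eRk_mono _ h

lemma trRank_union_le (S T : Set L) : trRank k (S ∪ T) ≤ trRank k S + trRank k T :=
  Matroid.eRk_union_le_eRk_add_eRk _ S T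

lemma trRank_biUnion_le {ι : Type*} (s : Finset ι) (S : ι → Set L) :
    trRank k (⋃ i ∈ s, S i) ≤ ∑ i ∈ s, trRank k (S i) := by
  classical
  induction s using Finset.induction_on with
  | empty => simp [trRank]
  | insert a s ha ih =>
    rw [Finset.set_biUnion_insert, Finset.sum_insert ha]
    exact (trRank_union_le k _ _).trans (by gcongr)

lemma le_trRank_of_algebraicIndependent {ι : Type*} {x : ι → L} (hx : AlgebraicIndependent k x)
    {S : Set L} (hS : ∀ i, x i ∈ S) : ENat.card ι ≤ trRank k S := by
  have h : (AlgebraicIndependent.matroid k L).Indep (Set.range x) := hx.coe_range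
  exact hx.injective.encard_range.trans <| h.encard_le_eRk_of_subset (Set.range_subset_iff.2 hS)

lemma exists_algebraicIndependent_trRank (S : Set L) :
    ∃ I ⊆ S, AlgebraicIndependent k ((↑) : I → L) ∧ ENat.card I = trRank k S := by
  obtain ⟨I, hIS, hI, hc⟩ := Matroid.le_eRk_iff.1 (le_refl (trRank k S))
  exact ⟨I, hIS, hI, hc⟩

lemma trRank_adjoin_le (S : Set L) :
    trRank k (IntermediateField.adjoin k S : Set L) ≤ trRank k S := by
  have h : (IntermediateField.adjoin k S : Set L) ⊆
      (AlgebraicIndependent.matroid k L).closure S := by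
    rw [AlgebraicIndependent.matroid_closure_eq]
    intro x hx
    obtain ⟨a, ha, b, hb, rfl⟩ := (IntermediateField.mem_adjoin_iff_div).1 hx
    rw [SetLike.mem_coe, Subalgebra.mem_algebraicClosure, div_eq_mul_inv]
    exact (isAlgebraic_algebraMap (⟨a, ha⟩ : Algebra.adjoin k S)).mul
      (isAlgebraic_algebraMap (⟨b, hb⟩ : Algebra.adjoin k S)).inv
  exact (Matroid.eRk_mono _ h).trans (Matroid.eRk_closure_eq _ S).le

lemma trRank_image (φ : L →ₐ[k] L') (S : Set L) : trRank k (φ '' S) = trRank k S := by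
  apply le_antisymm
  · obtain ⟨I, hI, hind, hc⟩ := exists_algebraicIndependent_trRank k (φ '' S)
    choose f hfS hf using fun i : I => hI i.2
    rw [← hc]
    refine le_trRank_of_algebraicIndependent (x := f) k ?_ hfS
    rw [← φ.algebraicIndependent_iff φ.injective]
    convert hind using 1
    exact funext hf
  · obtain ⟨I, hI, hind, hc⟩ := exists_algebraicIndependent_trRank k S
    rw [← hc]
    exact le_trRank_of_algebraicIndependent k (hind.map' φ.injective)
      fun i => Set.mem_image_of_mem _ (hI i.2)

variable {k} in
/-- If `u + b v` vanishes under `ψ`, with `ψ b ≠ 0`, specializing to `φ b = 0` kills `u`; hence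
`ψ b` is transcendental over lifts of algebraically independent elements. -/
lemma transcendental_of_specialization {A : Type*} [CommRing A] [Algebra k A]
    (φ : A →ₐ[k] L) (ψ : A →ₐ[k] L') (hker : ∀ a, ψ a = 0 → φ a = 0) {b : A}
    (hφ : φ b = 0) (hψ : ψ b ≠ 0) {ι : Type*} (a : ι → A)
    (ha : AlgebraicIndependent k (φ ∘ a)) :
    Transcendental (Algebra.adjoin k (Set.range (ψ ∘ a))) (ψ b) := by
  rintro ⟨p, hp, hpb⟩
  obtain ⟨q, hpq, hq⟩ := Polynomial.exists_eq_pow_rootMultiplicity_mul_and_not_dvd p hp 0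
  rw [map_zero, sub_zero] at hpq hq
  rw [hpq, map_mul, map_pow, Polynomial.aeval_X, mul_eq_zero,
    or_iff_right (pow_ne_zero _ hψ), ← Polynomial.X_mul_divX_add q] at hpb
  simp only [map_add, map_mul, Polynomial.aeval_X, Polynomial.aeval_C] at hpb
  have hlift : ∀ c ∈ Algebra.adjoin k (Set.range (ψ ∘ a)),
      ∃ P : MvPolynomial ι k, ψ (MvPolynomial.aeval a P) = c := by
    intro c hc
    rw [Algebra.adjoin_range_eq_range_aeval] at hc
    obtain ⟨P, rfl⟩ := hc
    exact ⟨P, MvPolynomial.comp_aeval_apply ..⟩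
  have hrange : Polynomial.aeval (ψ b) q.divX ∈ ψ.range := by
    rw [Polynomial.aeval_eq_sum_range]
    refine sum_mem fun i _ => ?_
    rw [Algebra.smul_def]
    obtain ⟨P, hP⟩ := hlift _ (q.divX.coeff i).2
    exact mul_mem ⟨_, hP⟩ (pow_mem (AlgHom.mem_range ψ |>.2 ⟨b, rfl⟩) i)
  obtain ⟨v, hv⟩ := hrange
  obtain ⟨P, hP⟩ := hlift _ (q.coeff 0).2
  have h0 : φ (b * v + MvPolynomial.aeval a P) = 0 := by
    apply hker
    rw [map_add, map_mul, hP]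
    exact (congrArg (ψ b * · + _) hv).trans hpb
  rw [map_add, map_mul, hφ, zero_mul, zero_add] at h0
  have hP0 : P = 0 := by
    apply ha
    rw [map_zero, ← h0, MvPolynomial.comp_aeval_apply]
    rfl
  apply hq
  rw [Polynomial.X_dvd_iff]
  ext
  rw [← hP, hP0, map_zero, map_zero, ZeroMemClass.coe_zero]

/-- Transcendence ranks drop strictly under strict specialization. -/
lemma trRank_range_add_one_le {A : Type*} [CommRing A] [Algebra k A]
    (φ : A →ₐ[k] L) (ψ : A →ₐ[k] L') (hker : ∀ a, ψ a = 0 → φ a = 0) {b : A}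
    (hφ : φ b = 0) (hψ : ψ b ≠ 0) :
    trRank k (Set.range φ) + 1 ≤ trRank k (Set.range ψ) := by
  obtain ⟨I, hI, hind, hc⟩ := exists_algebraicIndependent_trRank k (Set.range φ)
  choose a ha using fun i : I => hI i.2
  have hind' : AlgebraicIndependent k (φ ∘ a) := by
    convert hind using 1
    exact funext ha
  have h1 : AlgebraicIndependent k (ψ ∘ a) := by
    rw [AlgebraicIndependent, injective_iff_map_eq_zero]
    intro P hP
    refine (injective_iff_map_eq_zero _).1 hind' P ?_
    have h0 := hker (MvPolynomial.aeval a P) (by rwa [MvPolynomial.comp_aeval_apply])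
    rwa [MvPolynomial.comp_aeval_apply] at h0
  have h2 := AlgebraicIndependent.option_iff.2
    ⟨h1, transcendental_of_specialization φ ψ hker hφ hψ a hind'⟩
  have h3 := le_trRank_of_algebraicIndependent k h2 (S := Set.range ψ) (by
    rintro (_ | i)
    · exact ⟨b, rfl⟩
    · exact ⟨a i, rfl⟩)
  rwa [ENat.card_congr (Equiv.optionEquivSumPUnit.{0} I), ENat.card_sum, hc,
    ENat.card_eq_one_iff_unique.2 ⟨inferInstance⟩] at h3

/-- Any field extension has jointly independent embeddings, indexed by any set, in a common
extension field. -/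
lemma exists_independent_embeddings (k κ : Type) [Field k] [Field κ] [Algebra k κ] (ι : Type) :
    ∃ (L : Type) (_ : Field L) (_ : Algebra k L) (φ : ι → κ →ₐ[k] L),
      ENat.card ι * trRank k (Set.univ : Set κ) ≤ trRank k (⋃ i, Set.range (φ i)) := by
  obtain ⟨B, hB⟩ := exists_isTranscendenceBasis k κ
  let F := FractionRing (MvPolynomial (ι × B) k)
  let L := AlgebraicClosure F
  let X : ι × B → L := fun j => algebraMap (MvPolynomial (ι × B) k) L (MvPolynomial.X j)
  have hX : AlgebraicIndependent k X := by
    refine (MvPolynomial.algebraicIndependent_X (ι × B) k).map'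
      (f := IsScalarTower.toAlgHom k (MvPolynomial (ι × B) k) L) ?_
    change Function.Injective (algebraMap (MvPolynomial (ι × B) k) L)
    rw [IsScalarTower.algebraMap_eq (MvPolynomial (ι × B) k) F L]
    exact (algebraMap F L).injective.comp (IsFractionRing.injective _ _)
  have hex : ∀ i, ∃ φ : κ →ₐ[k] L, ∀ b : B, φ b = X (i, b) := by
    intro i
    have hi : AlgebraicIndependent k (fun b : B => X (i, b)) :=
      hX.comp (fun b => (i, b)) fun b c h => by simpa using h
    let R := Algebra.adjoin k (Set.range ((↑) : B → κ))
    let g : R →ₐ[k] L := (MvPolynomial.aeval fun b : B => X (i, b)).comp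
      (hB.1.aevalEquiv.symm : R →ₐ[k] MvPolynomial B k)
    have hi' : Function.Injective (MvPolynomial.aeval (R := k) fun b : B => X (i, b)) := hi
    have hg : Function.Injective g := hi'.comp hB.1.aevalEquiv.symm.injective
    let _ : Algebra R L := g.toRingHom.toAlgebra
    have : IsScalarTower k R L := IsScalarTower.of_algebraMap_eq fun x => (g.commutes x).symm
    have : Module.IsTorsionFree R L :=
      (Module.isTorsionFree_iff_algebraMap_injective (R := R) (A := L)).2 hg
    have : Algebra.IsAlgebraic R κ := hB.isAlgebraic
    let φ : κ →ₐ[R] L := IsAlgClosed.lift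
    refine ⟨φ.restrictScalars k, fun b => ?_⟩
    have hb : (b : κ) = algebraMap R κ (hB.1.aevalEquiv (MvPolynomial.X b)) := by simp
    rw [hb]
    change φ _ = _
    rw [φ.commutes]
    change (MvPolynomial.aeval fun b : B => X (i, b)) (hB.1.aevalEquiv.symm _) = _
    simp
  choose φ hφ using hex
  refine ⟨L, inferInstance, inferInstance, φ, ?_⟩
  have hBc : trRank k (Set.univ : Set κ) = ENat.card B := by
    have : (AlgebraicIndependent.matroid k κ).IsBase B := hB
    exact (this.encard_eq_eRank ▸ Matroid.eRk_ground _ :)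
  rw [hBc, ← ENat.card_prod]
  exact le_trRank_of_algebraicIndependent k hX fun j =>
    Set.mem_iUnion.2 ⟨j.1, j.2, hφ j.1 j.2⟩

end TranscendenceRank

/-! ## Field-valued points and the transcendence rank of a point -/

section FieldPoints

/-- The image in `L` of the residue field at the image of an `L`-valued point. -/
def fieldOf {L : Type} [Field L] {X : Scheme.{0}} (x : Spec (.of L) ⟶ X) : Set L :=
  Set.range (Scheme.SpecToEquivOfField L X x).2.hom

lemma fieldOf_map_comp_fromSpecResidueField {L : Type} [Field L] {X : Scheme.{0}} {w : X}
    (ψ : X.residueField w ⟶ .of L) :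
    fieldOf (Spec.map ψ ≫ X.fromSpecResidueField w) = Set.range ψ.hom := by
  have h := (Scheme.SpecToEquivOfField L X).apply_symm_apply ⟨w, ψ⟩
  unfold fieldOf
  change Set.range ((Scheme.SpecToEquivOfField L X)
    ((Scheme.SpecToEquivOfField L X).symm ⟨w, ψ⟩)).2.hom = _
  rw [h]

lemma exists_eq_map_comp_fromSpecResidueField {L : Type} [Field L] {X : Scheme.{0}}
    (x : Spec (.of L) ⟶ X) : ∃ ψ : X.residueField (x (IsLocalRing.closedPoint L)) ⟶ .of L,
      x = Spec.map ψ ≫ X.fromSpecResidueField _ ∧ fieldOf x = Set.range ψ.hom :=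
  ⟨_, ((Scheme.SpecToEquivOfField L X).symm_apply_apply x).symm, rfl⟩

lemma fieldOf_map_comp {L L' : Type} [Field L] [Field L'] {X : Scheme.{0}}
    (φ : L →+* L') (x : Spec (.of L) ⟶ X) :
    fieldOf (Spec.map (CommRingCat.ofHom φ) ≫ x) = φ '' fieldOf x := by
  obtain ⟨ψ, hx, h⟩ := exists_eq_map_comp_fromSpecResidueField x
  have h1 : Spec.map (CommRingCat.ofHom φ) ≫ x =
      Spec.map (ψ ≫ CommRingCat.ofHom φ) ≫ X.fromSpecResidueField _ := by
    rw [Spec.map_comp, Category.assoc, ← hx]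
  rw [h1, fieldOf_map_comp_fromSpecResidueField, h, ← Set.range_comp]
  rfl

lemma fieldOf_comp_subset {L : Type} [Field L] {X Y : Scheme.{0}}
    (x : Spec (.of L) ⟶ X) (g : X ⟶ Y) : fieldOf (x ≫ g) ⊆ fieldOf x := by
  obtain ⟨ψ, hx, h⟩ := exists_eq_map_comp_fromSpecResidueField x
  let b : Spec (.of (X.residueField (x (IsLocalRing.closedPoint L)))) ⟶ Y :=
    X.fromSpecResidueField (x (IsLocalRing.closedPoint L)) ≫ g
  have h1 : x ≫ g = Spec.map (CommRingCat.ofHom ψ.hom) ≫ b := by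
    conv_lhs => rw [hx, Category.assoc]
    rfl
  rw [h1, fieldOf_map_comp, h]
  exact Set.image_subset_range _ _

variable {K : Type} [Field K]

/-- The structure of a `K`-algebra on the residue field of a `K`-scheme. -/
abbrev residueAlgebra (W : Over (SpecK K)) (w : W.left) : Algebra K (W.left.residueField w) :=
  (Spec.preimage (W.left.fromSpecResidueField w ≫ W.hom)).hom.toAlgebra

/-- The transcendence degree of the residue field at a point of a `K`-scheme. -/
def rkPt (W : Over (SpecK K)) (w : W.left) : ℕ∞ :=
  letI := residueAlgebra W w
  trRank K (Set.univ : Set (W.left.residueField w))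

lemma map_preimage_comp (W : Over (SpecK K)) (w : W.left) {R : CommRingCat}
    (ψ : W.left.residueField w ⟶ R) :
    Spec.map (Spec.preimage (W.left.fromSpecResidueField w ≫ W.hom) ≫ ψ) =
      (Spec.map ψ ≫ W.left.fromSpecResidueField w) ≫ W.hom := by
  rw [Spec.map_comp, Spec.map_preimage, Category.assoc]

/-- The spectrum of an extension of `K`, as a `K`-scheme. -/
abbrev specOver (K L : Type) [Field K] [Field L] [Algebra K L] : Over (SpecK K) :=
  Over.mk (Spec.map (CommRingCat.ofHom (algebraMap K L)))

/-- The image of a field-valued point. -/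
def ptOf {L : Type} [Field L] [Algebra K L] {W : Over (SpecK K)} (x : specOver K L ⟶ W) :
    W.left := x.left.base (IsLocalRing.closedPoint L)

/-- `fieldOf` for points over `K`. -/
def fieldOfOver {L : Type} [Field L] [Algebra K L] {W : Over (SpecK K)}
    (x : specOver K L ⟶ W) : Set L := fieldOf (L := L) x.left

/-- A field-valued point factors through an embedding of the residue field over `K`. -/
lemma exists_algHom_of_point {L : Type} [Field L] [Algebra K L] {W : Over (SpecK K)}
    (x : specOver K L ⟶ W) :
    letI := residueAlgebra W (ptOf x)
    ∃ ψ : W.left.residueField (ptOf x) →ₐ[K] L,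
      x.left = Spec.map (CommRingCat.ofHom ψ.toRingHom) ≫ W.left.fromSpecResidueField _ ∧
      fieldOfOver x = Set.range ψ := by
  obtain ⟨ψ, hx, h⟩ := exists_eq_map_comp_fromSpecResidueField (L := L) x.left
  let _ := residueAlgebra W (ptOf x)
  have hc : Spec.preimage (W.left.fromSpecResidueField (ptOf x) ≫ W.hom) ≫ ψ =
      CommRingCat.ofHom (algebraMap K L) := by
    apply Spec.map_injective
    refine (map_preimage_comp W (ptOf x) ψ).trans (Eq.trans ?_ (Over.w x))
    exact congrArg (· ≫ W.hom) hx.symm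
  refine ⟨⟨ψ.hom, fun r => DFunLike.congr_fun (congrArg CommRingCat.Hom.hom hc) r⟩, hx, h⟩

/-- The field-valued point defined by an embedding of the residue field. -/
def pointOfAlgHom {L : Type} [Field L] [Algebra K L] (W : Over (SpecK K)) (w : W.left)
    (ψ : letI := residueAlgebra W w; W.left.residueField w →ₐ[K] L) : specOver K L ⟶ W :=
  letI := residueAlgebra W w
  Over.homMk (Spec.map (CommRingCat.ofHom ψ.toRingHom) ≫ W.left.fromSpecResidueField w) (by
    have h : CommRingCat.ofHom (algebraMap K L) =
      Spec.preimage (W.left.fromSpecResidueField w ≫ W.hom) ≫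
        CommRingCat.ofHom ψ.toRingHom := by
      ext r
      exact (ψ.commutes r).symm
    change _ = Spec.map (CommRingCat.ofHom (algebraMap K L))
    rw [h]
    exact (map_preimage_comp W w _).symm)

lemma ptOf_pointOfAlgHom {L : Type} [Field L] [Algebra K L] (W : Over (SpecK K)) (w : W.left)
    (ψ : letI := residueAlgebra W w; W.left.residueField w →ₐ[K] L) :
    ptOf (pointOfAlgHom W w ψ) = w :=
  W.left.fromSpecResidueField_apply w _

lemma fieldOfOver_pointOfAlgHom {L : Type} [Field L] [Algebra K L] (W : Over (SpecK K))
    (w : W.left) (ψ : letI := residueAlgebra W w; W.left.residueField w →ₐ[K] L) :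
    fieldOfOver (pointOfAlgHom W w ψ) = Set.range ψ :=
  fieldOf_map_comp_fromSpecResidueField _

lemma trRank_fieldOfOver {L : Type} [Field L] [Algebra K L] {W : Over (SpecK K)}
    (x : specOver K L ⟶ W) : trRank K (fieldOfOver x) = rkPt W (ptOf x) := by
  let _ := residueAlgebra W (ptOf x)
  obtain ⟨ψ, hx, h⟩ := exists_algHom_of_point x
  rw [h, ← Set.image_univ, trRank_image]
  rfl

lemma fieldOfOver_comp_subset {L : Type} [Field L] [Algebra K L] {W W' : Over (SpecK K)}
    (x : specOver K L ⟶ W) (g : W ⟶ W') : fieldOfOver (x ≫ g) ⊆ fieldOfOver x :=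
  fieldOf_comp_subset (L := L) x.left g.left

lemma exists_point (W : Over (SpecK K)) (w : W.left) :
    ∃ (L : Type) (_ : Field L) (_ : Algebra K L) (x : specOver K L ⟶ W), ptOf x = w :=
  letI := residueAlgebra W w
  ⟨W.left.residueField w, inferInstance, residueAlgebra W w, pointOfAlgHom W w (AlgHom.id K _),
    ptOf_pointOfAlgHom W w _⟩

lemma rkPt_map_le {W W' : Over (SpecK K)} (g : W ⟶ W') (w : W.left) :
    rkPt W' (g.left.base w) ≤ rkPt W w := by
  obtain ⟨L, _, _, x, rfl⟩ := exists_point W w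
  have : g.left.base (ptOf x) = ptOf (x ≫ g) := rfl
  rw [this, ← trRank_fieldOfOver, ← trRank_fieldOfOver]
  exact trRank_mono K (fieldOfOver_comp_subset x g)

/-- A point of a product is defined over the field generated by its coordinates. -/
lemma trRank_fieldOfOver_pi_le {L : Type} [Field L] [Algebra K L] {E : Type} [Finite E]
    (W : E → Over (SpecK K)) (x : specOver K L ⟶ ∏ᶜ W) :
    trRank K (fieldOfOver x) ≤ trRank K (⋃ e, fieldOfOver (x ≫ Pi.π W e)) := by
  set S := ⋃ e, fieldOfOver (x ≫ Pi.π W e) with hS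
  let L₀ := IntermediateField.adjoin K S
  let ι : specOver K L ⟶ specOver K L₀ :=
    Over.homMk (Spec.map (CommRingCat.ofHom L₀.val.toRingHom)) (by
      change Spec.map _ ≫ Spec.map _ = Spec.map _
      rw [← Spec.map_comp]
      rfl)
  have hfac : ∀ e, ∃ y : specOver K L₀ ⟶ W e, ι ≫ y = x ≫ Pi.π W e := by
    intro e
    let _ := residueAlgebra (W e) (ptOf (x ≫ Pi.π W e))
    obtain ⟨ψ, hx, h⟩ := exists_algHom_of_point (x ≫ Pi.π W e)
    have hmem : ∀ a, ψ a ∈ L₀ := fun a => IntermediateField.subset_adjoin K S <|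
      Set.mem_iUnion.2 ⟨e, h ▸ Set.mem_range_self a⟩
    refine ⟨pointOfAlgHom (W e) _ (ψ.codRestrict L₀.toSubalgebra hmem), ?_⟩
    ext1
    rw [hx]
    change Spec.map _ ≫ Spec.map _ ≫ _ = _
    rw [← Category.assoc, ← Spec.map_comp]
    rfl
  choose y hy using hfac
  have hxy : x = ι ≫ Pi.lift y := by
    refine Pi.hom_ext _ _ fun e => ?_
    rw [Category.assoc, Pi.lift_π, hy]
  have hsub : fieldOfOver x ⊆ (L₀ : Set L) := by
    rw [hxy]
    change fieldOf (Spec.map (CommRingCat.ofHom L₀.val.toRingHom) ≫ (Pi.lift y).left) ⊆ _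
    rw [fieldOf_map_comp]
    rintro _ ⟨a, -, rfl⟩
    exact a.2
  exact (trRank_mono K hsub).trans (trRank_adjoin_le K S)

end FieldPoints

section PointRank

variable {K : Type} [Field K]

lemma rkPt_add_one_le (W : Over (SpecK K)) {w η : W.left} (h : η ⤳ w) (hne : w ≠ η) :
    rkPt W w + 1 ≤ rkPt W η := by
  let _ := residueAlgebra W w
  let _ := residueAlgebra W η
  let _ : Algebra K (W.left.presheaf.stalk w) :=
    (Spec.preimage (W.left.fromSpecStalk w ≫ W.hom)).hom.toAlgebra
  have hφ : Spec.preimage (W.left.fromSpecStalk w ≫ W.hom) ≫ W.left.residue w =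
      Spec.preimage (W.left.fromSpecResidueField w ≫ W.hom) := by
    apply Spec.map_injective
    rw [Spec.map_comp, Spec.map_preimage, Spec.map_preimage, Scheme.fromSpecResidueField,
      Category.assoc]
  let ψ₀ := W.left.presheaf.stalkSpecializes h ≫ W.left.residue η
  have hψ₀ : Spec.map ψ₀ ≫ W.left.fromSpecStalk w = W.left.fromSpecResidueField η := by
    rw [Spec.map_comp, Category.assoc, Scheme.SpecMap_stalkSpecializes_fromSpecStalk,
      Scheme.fromSpecResidueField]
  have hψ : Spec.preimage (W.left.fromSpecStalk w ≫ W.hom) ≫ ψ₀ =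
      Spec.preimage (W.left.fromSpecResidueField η ≫ W.hom) := by
    apply Spec.map_injective
    rw [Spec.map_comp, Spec.map_preimage, Spec.map_preimage, ← Category.assoc, hψ₀]
  let φ : W.left.presheaf.stalk w →ₐ[K] W.left.residueField w :=
    ⟨(W.left.residue w).hom, fun r =>
      DFunLike.congr_fun (congrArg CommRingCat.Hom.hom hφ) r⟩
  let ψ : W.left.presheaf.stalk w →ₐ[K] W.left.residueField η :=
    ⟨ψ₀.hom, fun r => DFunLike.congr_fun (congrArg CommRingCat.Hom.hom hψ) r⟩
  have hker : ∀ a, ψ a = 0 → φ a = 0 := by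
    intro a ha
    by_contra hne
    have hu : IsUnit a := by
      by_contra hu
      exact hne ((IsLocalRing.residue_eq_zero_iff a).2 ((IsLocalRing.mem_maximalIdeal a).2 hu))
    exact (hu.map ψ).ne_zero ha
  have hb : ∃ b, φ b = 0 ∧ ψ b ≠ 0 := by
    by_contra! hb
    have hloc : IsLocalHom ψ₀.hom := by
      refine ⟨fun a ha => ?_⟩
      by_contra hu
      exact ha.ne_zero
        (hb a ((IsLocalRing.residue_eq_zero_iff a).2 ((IsLocalRing.mem_maximalIdeal a).2 hu)))
    have h1 : Spec.map ψ₀ (IsLocalRing.closedPoint (W.left.residueField η)) =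
        IsLocalRing.closedPoint (W.left.presheaf.stalk w) :=
      IsLocalRing.comap_closedPoint ψ₀.hom
    have h2 := W.left.fromSpecResidueField_apply η
      (IsLocalRing.closedPoint (W.left.residueField η))
    rw [← hψ₀] at h2
    refine hne (W.left.fromSpecStalk_closedPoint.symm.trans (Eq.trans ?_ h2))
    exact congrArg (W.left.fromSpecStalk w) h1.symm
  obtain ⟨b, hb0, hb1⟩ := hb
  have hs : Set.range φ = Set.univ := (W.left.residue_surjective w).range_eq
  have key := trRank_range_add_one_le K φ ψ hker hb0 hb1
  rw [hs] at key
  exact key.trans (trRank_mono K (Set.subset_univ _))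

lemma rkPt_lt_top (W : Over (SpecK K)) [LocallyOfFiniteType W.hom] (w : W.left) :
    rkPt W w < ⊤ := by
  obtain ⟨B, j, _, p, rfl⟩ := W.left.exists_Spec_apply_eq w
  obtain ⟨α, hα⟩ : ∃ α, Spec.map α = j ≫ W.hom := Spec.homEquiv.symm.surjective _
  have hft : α.hom.FiniteType := by
    have : LocallyOfFiniteType (Spec.map α) := hα ▸ locallyOfFiniteType_comp j W.hom
    exact HasRingHomProperty.Spec_iff.mp this
  let g : Over.mk (Spec.map α) ⟶ W := Over.homMk j hα.symm
  refine (rkPt_map_le g p).trans_lt ?_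
  obtain ⟨L, _, _, x, rfl⟩ := exists_point (Over.mk (Spec.map α)) p
  rw [← trRank_fieldOfOver]
  obtain ⟨θ, hθ⟩ : ∃ θ : B ⟶ .of L, Spec.map θ = x.left := Spec.homEquiv.symm.surjective _
  have hαθ : α ≫ θ = CommRingCat.ofHom (algebraMap K L) := by
    apply Spec.map_injective
    rw [Spec.map_comp, hθ]
    exact Over.w x
  algebraize [α.hom]
  obtain ⟨s, hs⟩ := (inferInstance : Algebra.FiniteType K B).out
  let θ' : _ →ₐ[K] L := ⟨θ.hom, fun r => DFunLike.congr_fun (congrArg CommRingCat.Hom.hom hαθ) r⟩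
  let L₀ := IntermediateField.adjoin K (θ' '' (s : Set B))
  have hmem : ∀ a, θ' a ∈ L₀ := by
    intro a
    have ha : a ∈ Algebra.adjoin K (s : Set _) := hs ▸ Algebra.mem_top
    have : θ' a ∈ (Algebra.adjoin K (s : Set B)).map θ' := ⟨a, ha, rfl⟩
    rw [AlgHom.map_adjoin] at this
    exact IntermediateField.algebra_adjoin_le_adjoin K _ this
  have hfac : x.left = Spec.map (CommRingCat.ofHom L₀.val.toRingHom) ≫
      Spec.map (CommRingCat.ofHom (θ'.codRestrict L₀.toSubalgebra hmem).toRingHom) := by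
    rw [← hθ, ← Spec.map_comp]
    rfl
  have hsub : fieldOfOver x ⊆ (L₀ : Set L) := by
    unfold fieldOfOver
    rw [hfac, fieldOf_map_comp]
    rintro _ ⟨a, -, rfl⟩
    exact a.2
  refine ((trRank_mono K hsub).trans (trRank_adjoin_le K _)).trans_lt ?_
  refine (Matroid.eRk_le_encard _ _).trans_lt ?_
  exact Set.encard_lt_top_iff.2 (s.finite_toSet.image _)

/-- Independent generic points give a point of a power whose rank is as large as possible. -/
lemma exists_rkPt_pow_ge (V : Over (SpecK K)) (η : V.left) (F : Type) [Finite F] :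
    ∃ z : (pow K V F).left, ENat.card F * rkPt V η ≤ rkPt (pow K V F) z := by
  let _ := residueAlgebra V η
  obtain ⟨L, _, _, φ, hφ⟩ := exists_independent_embeddings K (V.left.residueField η) F
  let x : specOver K L ⟶ pow K V F := Pi.lift fun i => pointOfAlgHom V η (φ i)
  refine ⟨ptOf x, ?_⟩
  rw [← trRank_fieldOfOver]
  refine hφ.trans (trRank_mono K (Set.iUnion_subset fun i => ?_))
  have h : x ≫ Pi.π _ i = pointOfAlgHom V η (φ i) := Pi.lift_π _ _
  rw [← fieldOfOver_pointOfAlgHom, ← h]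
  exact fieldOfOver_comp_subset x _

end PointRank

section FiniteTypePowers

lemma overObj_isClosedUnderFiniteProducts {C : Type*} [Category C] [HasPullbacks C] {B : C}
    [HasFiniteProducts (Over B)] (P : MorphismProperty C) [P.IsMultiplicative]
    [P.IsStableUnderBaseChange] :
    (P.overObj (X := B)).IsClosedUnderFiniteProducts := by
  have : (P.overObj (X := B)).IsClosedUnderBinaryProducts := by
    refine ⟨?_⟩
    rintro X ⟨p⟩
    have hl := (IsLimit.postcomposeHomEquiv (diagramIsoPair p.diag) _).symm p.isLimit
    have hp := Over.isPullback_of_binaryFan_isLimit _ hl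
    have h1 := P.of_isPullback hp (p.prop_diag_obj ⟨WalkingPair.left⟩)
    have h2 := P.comp_mem _ _ h1 (p.prop_diag_obj ⟨WalkingPair.right⟩)
    exact (congrArg (@P X.left B) (Over.w
      (BinaryFan.snd ((Cone.postcompose (diagramIsoPair p.diag).hom).obj ⟨X, p.π⟩)))).mp h2
  exact ObjectProperty.IsClosedUnderFiniteProducts.mk'

variable {K : Type} [Field K]

lemma locallyOfFiniteType_pow (V : Over (SpecK K)) (hV : LocallyOfFiniteType V.hom) (Ω : Type)
    [Finite Ω] : LocallyOfFiniteType (pow K V Ω).hom := by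
  have := overObj_isClosedUnderFiniteProducts (B := SpecK K) @LocallyOfFiniteType
  exact ObjectProperty.prop_product (P := MorphismProperty.overObj @LocallyOfFiniteType)
    (f := fun _ : Ω => V) fun _ => hV

lemma quasiCompact_pow (V : Over (SpecK K)) (hV : QuasiCompact V.hom) (Ω : Type)
    [Finite Ω] : QuasiCompact (pow K V Ω).hom := by
  have := overObj_isClosedUnderFiniteProducts (B := SpecK K) @QuasiCompact
  exact ObjectProperty.prop_product (P := MorphismProperty.overObj @QuasiCompact)
    (f := fun _ : Ω => V) fun _ => hV

end FiniteTypePowers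

section ClosedPoints

variable {K : Type} [Field K]

lemma jacobsonSpace_left (W : Over (SpecK K)) [LocallyOfFiniteType W.hom] :
    JacobsonSpace W.left :=
  LocallyOfFiniteType.jacobsonSpace W.hom

lemma exists_ev_eq [IsAlgClosed K] {W : Over (SpecK K)} [LocallyOfFiniteType W.hom] {w : W.left}
    (hw : w ∈ closedPoints W.left) : ∃ a : Pt K W, ev K a = w :=
  ⟨Over.homMk (pointOfClosedPoint W.hom w hw) (pointOfClosedPoint_comp W.hom w hw),
    pointOfClosedPoint_apply W.hom w hw _⟩

lemma exists_ev_mem [IsAlgClosed K] (W : Over (SpecK K)) [LocallyOfFiniteType W.hom]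
    {U : Set W.left} (hU : IsLocallyClosed U) (hne : U.Nonempty) : ∃ a : Pt K W, ev K a ∈ U := by
  have := jacobsonSpace_left W
  obtain ⟨w, hw, hc⟩ := nonempty_inter_closedPoints hne hU
  obtain ⟨a, rfl⟩ := exists_ev_eq hc
  exact ⟨a, hw⟩

/-- A morphism out of a variety whose constructible image contains all rational points is
surjective, also when restricted to a closed subset. -/
lemma image_eq_univ_of_forall_ev_mem [IsAlgClosed K] {W W' : Over (SpecK K)}
    [LocallyOfFiniteType W.hom] [QuasiCompact W.hom] [LocallyOfFiniteType W'.hom]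
    [QuasiCompact W'.hom] (g : W ⟶ W') {Z : Set W.left} (hZ : IsClosed Z)
    (h : ∀ a : Pt K W', ev K a ∈ g.left.base '' Z) : g.left.base '' Z = Set.univ := by
  have : IsLocallyNoetherian W'.left := LocallyOfFiniteType.isLocallyNoetherian W'.hom
  have : IsLocallyNoetherian W.left := LocallyOfFiniteType.isLocallyNoetherian W.hom
  have : CompactSpace W'.left := QuasiCompact.compactSpace_of_compactSpace W'.hom
  have : CompactSpace W.left := QuasiCompact.compactSpace_of_compactSpace W.hom
  have : IsNoetherian W'.left := {}
  have : IsNoetherian W.left := {}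
  have : LocallyOfFiniteType (g.left ≫ W'.hom) := by rw [Over.w]; infer_instance
  have : LocallyOfFiniteType g.left := locallyOfFiniteType_of_comp g.left W'.hom
  have hc : IsConstructible Z := by
    have : IsConstructible Zᶜ :=
      (TopologicalSpace.NoetherianSpace.isCompact _).isConstructible hZ.isOpen_compl
    simpa using this.compl
  have hi : IsConstructible (g.left.base '' Z) := g.left.isConstructible_image hc
  have key : ∀ (s : Set W'.left) (_ : IsConstructible s), s.Nonempty → ∃ a, ev K a ∈ s := by
    intro s hs
    have : Nonempty {U : Set W'.left // IsOpen U} := ⟨⟨∅, isOpen_empty⟩⟩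
    refine IsConstructible.induction_of_isTopologicalBasis
      (P := fun s _ => s.Nonempty → ∃ a, ev K a ∈ s)
      (Subtype.val : {U : Set W'.left // IsOpen U} → Set W'.left)
      (by convert TopologicalSpace.isTopologicalBasis_opens; exact Subtype.range_coe)
      (fun _ => TopologicalSpace.NoetherianSpace.isCompact _) ?_ ?_ s hs
    · intro U s _
      exact exists_ev_mem W' (U.2.isLocallyClosed.inter
        (isOpen_biUnion fun j _ => j.2).isClosed_compl.isLocallyClosed)
    · rintro s - t - hs ht ⟨w, hw | hw⟩
      · exact (hs ⟨w, hw⟩).imp fun a => Or.inl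
      · exact (ht ⟨w, hw⟩).imp fun a => Or.inr
  by_contra hne
  obtain ⟨a, ha⟩ := key _ hi.compl (Set.nonempty_compl.2 hne)
  exact ha (h a)

end ClosedPoints

section Powers

variable {K : Type} [Field K] (V : Over (SpecK K))

/-- The `i`-th coordinate on a power of `V`. -/
def coord {Ω : Type} [Finite Ω] (i : Ω) : pow K V Ω ⟶ V := Pi.π _ i

/-- The morphism to a power of `V` with given coordinates. -/
def powLift {W : Over (SpecK K)} {Ω : Type} [Finite Ω] (p : Ω → (W ⟶ V)) : W ⟶ pow K V Ω :=
  Pi.lift p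

variable {V}

lemma powLift_coord {W : Over (SpecK K)} {Ω : Type} [Finite Ω] (p : Ω → (W ⟶ V)) (i : Ω) :
    powLift V p ≫ coord V i = p i :=
  Pi.lift_π _ _

lemma ptPow_coord {Ω : Type} [Finite Ω] (u : Ω → Pt K V) (i : Ω) :
    ptPow K V Ω u ≫ coord V i = u i :=
  Pi.lift_π _ _

lemma pow_hom_ext {W : Over (SpecK K)} {Ω : Type} [Finite Ω] {x y : W ⟶ pow K V Ω}
    (h : ∀ i, x ≫ coord V i = y ≫ coord V i) : x = y :=
  Pi.hom_ext _ _ h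

lemma exists_ptPow_eq {Ω : Type} [Finite Ω] (a : Pt K (pow K V Ω)) :
    ∃ u, ptPow K V Ω u = a :=
  ⟨fun i => a ≫ coord V i, pow_hom_ext fun i => ptPow_coord _ i⟩

variable (V)

/-- The morphism between powers of `V` induced by a map of index sets. -/
def reindex {Ω E : Type} [Finite Ω] [Finite E] (j : Ω → E) : pow K V E ⟶ pow K V Ω :=
  powLift V fun ω => coord V (j ω)

lemma reindex_coord {Ω E : Type} [Finite Ω] [Finite E] (j : Ω → E) (ω : Ω) :
    reindex V j ≫ coord V ω = coord V (j ω) :=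
  powLift_coord _ _

lemma ptPow_reindex {Ω E : Type} [Finite Ω] [Finite E] (j : Ω → E) (u : E → Pt K V) :
    ptPow K V E u ≫ reindex V j = ptPow K V Ω (u ∘ j) := by
  refine pow_hom_ext fun ω => ?_
  rw [Category.assoc, reindex_coord, ptPow_coord, ptPow_coord, Function.comp_apply]

open Classical in
/-- The inclusion of `V` in a power as the `i`-th coordinate line through a rational point. -/
def coordLine {Ω : Type} [Finite Ω] (u : Ω → Pt K V) (i : Ω) : V ⟶ pow K V Ω :=
  powLift V fun j => if j = i then 𝟙 V else Over.mkIdTerminal.from V ≫ u j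

lemma comp_coordLine {Ω : Type} [Finite Ω] [DecidableEq Ω] (u : Ω → Pt K V) (i : Ω) (a : Pt K V) :
    a ≫ coordLine V u i = ptPow K V Ω (Function.update u i a) := by
  refine pow_hom_ext fun j => ?_
  rw [Category.assoc, ptPow_coord, coordLine, powLift_coord]
  by_cases h : j = i
  · subst h
    simp
  · have : a ≫ Over.mkIdTerminal.from V = 𝟙 _ := Over.mkIdTerminal.hom_ext _ _
    rw [if_neg h, Function.update_of_ne h, ← Category.assoc, this, Category.id_comp]

lemma irreducibleSpace_pow [IsAlgClosed K] [LocallyOfFiniteType V.hom] [IrreducibleSpace V.left]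
    (Ω : Type) [Finite Ω] : IrreducibleSpace (pow K V Ω).left := by
  classical
  have := Fintype.ofFinite Ω
  have := locallyOfFiniteType_pow V inferInstance Ω
  have hne : ∀ {U : Set V.left}, IsOpen U → U.Nonempty → ∃ a : Pt K V, ev K a ∈ U :=
    fun hU => exists_ev_mem V hU.isLocallyClosed
  obtain ⟨a₀, -⟩ := hne isOpen_univ Set.univ_nonempty
  have : Nonempty (pow K V Ω).left := ⟨ev K (ptPow K V Ω fun _ => a₀)⟩
  refine { toPreirreducibleSpace := ⟨?_⟩, toNonempty := this }
  rintro U U' hU hU' ⟨w, -, hw⟩ ⟨w', -, hw'⟩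
  have key : ∀ S : Finset Ω, ∃ u u' : Ω → Pt K V, ev K (ptPow K V Ω u) ∈ U ∧
      ev K (ptPow K V Ω u') ∈ U' ∧ ∀ i ∈ S, u i = u' i := by
    intro S
    induction S using Finset.induction_on with
    | empty =>
      obtain ⟨a, ha⟩ := exists_ev_mem _ hU.isLocallyClosed ⟨w, hw⟩
      obtain ⟨a', ha'⟩ := exists_ev_mem _ hU'.isLocallyClosed ⟨w', hw'⟩
      obtain ⟨u, rfl⟩ := exists_ptPow_eq a
      obtain ⟨u', rfl⟩ := exists_ptPow_eq a'
      exact ⟨u, u', ha, ha', by simp⟩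
    | insert i S _ ih =>
      obtain ⟨u, u', hu, hu', h⟩ := ih
      have hmem : ∀ (v : Ω → Pt K V) (O : Set (pow K V Ω).left) (a : Pt K V),
          ev K a ∈ (coordLine V v i).left.base ⁻¹' O ↔
            ev K (ptPow K V Ω (Function.update v i a)) ∈ O := by
        intro v O a
        rw [← comp_coordLine]
        rfl
      obtain ⟨x, hx⟩ := nonempty_preirreducible_inter
        (hU.preimage (coordLine V u i).left.continuous)
        (hU'.preimage (coordLine V u' i).left.continuous)
        ⟨ev K (u i), (hmem _ _ _).2 (by rwa [Function.update_eq_self])⟩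
        ⟨ev K (u' i), (hmem _ _ _).2 (by rwa [Function.update_eq_self])⟩
      obtain ⟨a, ha, ha'⟩ := hne ((hU.preimage (coordLine V u i).left.continuous).inter
        (hU'.preimage (coordLine V u' i).left.continuous)) ⟨x, hx⟩
      refine ⟨_, _, (hmem _ _ _).1 ha, (hmem _ _ _).1 ha', fun k hk => ?_⟩
      by_cases hki : k = i
      · subst hki
        simp
      · simp [hki, h k (Finset.mem_of_mem_insert_of_ne hk hki)]
  obtain ⟨u, u', hu, hu', h⟩ := key Finset.univ
  obtain rfl : u = u' := funext fun i => h i (Finset.mem_univ i)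
  exact ⟨_, Set.mem_univ _, hu, hu'⟩

lemma rkPt_le_genericPoint (W : Over (SpecK K)) [IrreducibleSpace W.left] (w : W.left) :
    rkPt W w ≤ rkPt W (genericPoint W.left) := by
  by_cases h : w = genericPoint W.left
  · rw [h]
  · exact le_self_add.trans (rkPt_add_one_le W (genericPoint_specializes w) h)

lemma rkPt_pow_le [IrreducibleSpace V.left] {Ω : Type} [Finite Ω] (w : (pow K V Ω).left) :
    rkPt (pow K V Ω) w ≤ Nat.card Ω * rkPt V (genericPoint V.left) := by
  have := Fintype.ofFinite Ω
  obtain ⟨L, _, _, x, rfl⟩ := exists_point _ w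
  rw [← trRank_fieldOfOver]
  refine (trRank_fieldOfOver_pi_le _ x).trans ?_
  have h := trRank_biUnion_le K Finset.univ
    fun i : Ω => fieldOfOver (x ≫ coord V i)
  simp only [Finset.mem_univ, Set.iUnion_true] at h
  refine h.trans ((Finset.sum_le_card_nsmul _ _ (rkPt V (genericPoint V.left))
    fun i _ => ?_).trans ?_)
  · rw [trRank_fieldOfOver]
    exact rkPt_le_genericPoint V _
  · rw [nsmul_eq_mul, Finset.card_univ, Nat.card_eq_fintype_card]

/-- Each of a disjoint family of tiles on which a point of a power lies in a fixed proper closed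
subset lowers the rank of that point. -/
lemma rkPt_add_card_le [IsAlgClosed K] [LocallyOfFiniteType V.hom] [IrreducibleSpace V.left]
    {Ω E T : Type} [Finite Ω] [Finite E] [Finite T] (j : T → Ω → E)
    (hj : Function.Injective (Function.uncurry j)) {H : Set (pow K V Ω).left} (hH : IsClosed H)
    (hne : H ≠ Set.univ) (z : (pow K V E).left)
    (hz : ∀ t, (reindex V (j t)).left.base z ∈ H) :
    rkPt (pow K V E) z + Nat.card T ≤ Nat.card E * rkPt V (genericPoint V.left) := by
  classical
  have := Fintype.ofFinite Ω
  have := Fintype.ofFinite E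
  have := Fintype.ofFinite T
  have := irreducibleSpace_pow V Ω
  set d := rkPt V (genericPoint V.left)
  obtain ⟨L, _, _, x, rfl⟩ := exists_point _ z
  let R : E → Set L := fun e => fieldOfOver (x ≫ coord V e)
  let Q : T → Set L := fun t => fieldOfOver (x ≫ reindex V (j t))
  let C : Finset E := (Finset.univ.image (Function.uncurry j))ᶜ
  have hcard : Fintype.card T * Fintype.card Ω + C.card = Fintype.card E := by
    rw [Finset.card_compl, Finset.card_image_of_injective _ hj, Finset.card_univ,
      Fintype.card_prod]
    have := Fintype.card_le_of_injective _ hj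
    rw [Fintype.card_prod] at this
    omega
  have hsub : (⋃ e, R e) ⊆ (⋃ t ∈ Finset.univ, Q t) ∪ ⋃ e ∈ C, R e := by
    refine Set.iUnion_subset fun e => ?_
    by_cases he : e ∈ C
    · exact (Set.subset_biUnion_of_mem (u := R) he).trans Set.subset_union_right
    · obtain ⟨⟨t, ω⟩, -, rfl⟩ : ∃ p ∈ Finset.univ, Function.uncurry j p = e := by
        simpa [C] using he
      refine Set.Subset.trans ?_ ((Set.subset_biUnion_of_mem (u := Q)
        (Finset.mem_univ t)).trans Set.subset_union_left)
      have := fieldOfOver_comp_subset (x ≫ reindex V (j t)) (coord V ω)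
      rwa [Category.assoc, reindex_coord] at this
  have hQ : ∀ t, trRank K (Q t) + 1 ≤ Fintype.card Ω * d := by
    intro t
    rw [trRank_fieldOfOver, ← Nat.card_eq_fintype_card]
    refine (rkPt_add_one_le _ (genericPoint_specializes _) fun h => hne ?_).trans
      (rkPt_pow_le V (genericPoint _))
    refine hH.closure_eq.symm.trans (Set.eq_univ_of_univ_subset ?_)
    rw [← genericPoint_closure (α := (pow K V Ω).left), ← h]
    exact closure_mono (Set.singleton_subset_iff.2 (hz t))
  have hR : ∀ e, trRank K (R e) ≤ d := fun e => by
    rw [trRank_fieldOfOver]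
    exact rkPt_le_genericPoint V _
  rw [← trRank_fieldOfOver, Nat.card_eq_fintype_card, Nat.card_eq_fintype_card]
  calc trRank K (fieldOfOver x) + (Fintype.card T : ℕ∞)
      ≤ (∑ t, trRank K (Q t) + ∑ e ∈ C, trRank K (R e)) + (Fintype.card T : ℕ∞) := by
        gcongr
        exact (trRank_fieldOfOver_pi_le _ x).trans <| (trRank_mono K hsub).trans <|
          (trRank_union_le K _ _).trans <|
          add_le_add (trRank_biUnion_le K _ _) (trRank_biUnion_le K _ _)
    _ = ∑ t, (trRank K (Q t) + 1) + ∑ e ∈ C, trRank K (R e) := by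
        rw [Finset.sum_add_distrib]
        simp only [Finset.sum_const, Finset.card_univ, nsmul_eq_mul, mul_one]
        exact add_right_comm _ _ _
    _ ≤ ∑ _t : T, Fintype.card Ω * d + ∑ _e ∈ C, d :=
        add_le_add (Finset.sum_le_sum fun t _ => hQ t) (Finset.sum_le_sum fun e _ => hR e)
    _ = Fintype.card E * d := by
        simp only [Finset.sum_const, Finset.card_univ, nsmul_eq_mul]
        rw [← hcard]
        push_cast
        ring

end Powers

section Tiles

open scoped Pointwise

variable {G : Type} [Group G]

/-- Every finite subset of a group contains comparatively many elements translating a given finite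
set to pairwise disjoint sets. -/
lemma exists_disjoint_translates [DecidableEq G] (F Ω : Finset G) :
    ∃ T ⊆ F, (∀ t ∈ T, ∀ t' ∈ T, ∀ ω ∈ Ω, ∀ ω' ∈ Ω, t * ω = t' * ω' → t = t') ∧
      F.card ≤ T.card * (insert 1 (Ω * Ω⁻¹)).card := by
  let P : Finset G → Prop := fun T =>
    ∀ t ∈ T, ∀ t' ∈ T, ∀ ω ∈ Ω, ∀ ω' ∈ Ω, t * ω = t' * ω' → t = t'
  classical
  obtain ⟨T, hT, hmax⟩ := (F.powerset.filter P).exists_max_image Finset.card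
    ⟨∅, by simp [P]⟩
  rw [Finset.mem_filter, Finset.mem_powerset] at hT
  refine ⟨T, hT.1, hT.2, (Finset.card_le_card fun g hg => ?_).trans Finset.card_mul_le⟩
  by_contra hgT
  have hg1 : g ∉ T := fun h => hgT (Finset.mem_mul.2 ⟨g, h, 1, by simp, mul_one g⟩)
  have hdis : ∀ t ∈ T, ∀ ω ∈ Ω, ∀ ω' ∈ Ω, g * ω ≠ t * ω' := by
    intro t ht ω hω ω' hω' h
    refine hgT (Finset.mem_mul.2 ⟨t, ht, ω' * ω⁻¹, ?_, ?_⟩)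
    · exact Finset.mem_insert_of_mem (Finset.mul_mem_mul hω' (Finset.inv_mem_inv hω))
    · rw [← mul_assoc, ← h, mul_inv_cancel_right]
  have := hmax (insert g T) (Finset.mem_filter.2 ⟨Finset.mem_powerset.2
    (Finset.insert_subset hg hT.1), ?_⟩)
  · rw [Finset.card_insert_of_notMem hg1] at this
    omega
  · intro t ht t' ht' ω hω ω' hω' h
    rcases Finset.mem_insert.1 ht with rfl | h1 <;> rcases Finset.mem_insert.1 ht' with rfl | h2
    · rfl
    · exact (hdis _ h2 _ hω _ hω' h).elim
    · exact (hdis _ h1 _ hω' _ hω h.symm).elim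
    · exact hT.2 _ h1 _ h2 _ hω _ hω' h

lemma card_mul_le_add_sum [DecidableEq G] (F N : Finset G) :
    (F ∪ F * N).card ≤
      F.card + ∑ n ∈ N, ((F : Set G) \ ((· * n⁻¹) '' (F : Set G))).ncard := by
  have hsub : F ∪ F * N ⊆ F ∪ N.biUnion fun n => (F.image (· * n)) \ F := by
    refine Finset.union_subset Finset.subset_union_left fun x hx => ?_
    obtain ⟨g, hg, n, hn, rfl⟩ := Finset.mem_mul.1 hx
    by_cases h : g * n ∈ F
    · exact Finset.mem_union_left _ h
    · exact Finset.mem_union_right _ (Finset.mem_biUnion.2 ⟨n, hn,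
        Finset.mem_sdiff.2 ⟨Finset.mem_image_of_mem _ hg, h⟩⟩)
  refine (Finset.card_le_card hsub).trans ((Finset.card_union_le _ _).trans ?_)
  gcongr
  refine Finset.card_biUnion_le.trans (Finset.sum_le_sum fun n _ => ?_)
  rw [← Finset.coe_image, ← Finset.coe_sdiff, Set.ncard_coe_finset]
  refine Finset.card_le_card_of_injOn (· * n⁻¹) (fun x hx => ?_)
    ((mul_left_injective n⁻¹).injOn)
  rw [Finset.mem_coe, Finset.mem_sdiff] at hx
  obtain ⟨g, hg, rfl⟩ := Finset.mem_image.1 hx.1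
  rw [Finset.mem_coe, Finset.mem_sdiff]
  refine ⟨by simpa using hg, fun h => hx.2 ?_⟩
  obtain ⟨g', hg', he⟩ := Finset.mem_image.1 h
  rwa [← mul_right_cancel he]

end Tiles

section CellularAutomata

variable {K : Type} [Field K] {V : Over (SpecK K)} {G : Type} [Group G]

lemma IsAlgCA.translate {τ : (G → Pt K V) → (G → Pt K V)} (hca : IsAlgCA K V τ)
    (x : G → Pt K V) (t g : G) : τ (fun h => x (t * h)) g = τ x (t * g) := by
  obtain ⟨M, f, h⟩ := hca
  rw [h, h]
  simp only [mul_assoc]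

/-- A configuration can be changed on a disjoint family of tiles so that its patterns there lie in
`H`, without changing its image. -/
lemma exists_tiles_mem {τ : (G → Pt K V) → (G → Pt K V)} (hca : IsAlgCA K V τ) {Ω : Finset G}
    {H : Set (↥Ω → Pt K V)}
    (hH : ∀ p : {g : G // g ∉ Ω} → Pt K V, τ '' cyl K V Ω Set.univ p = τ '' cyl K V Ω H p)
    (y : G → Pt K V) (T : Finset G)
    (hT : ∀ t ∈ T, ∀ t' ∈ T, ∀ ω ∈ Ω, ∀ ω' ∈ Ω, t * ω = t' * ω' → t = t') :
    ∃ y' : G → Pt K V, τ y' = τ y ∧ ∀ t ∈ T, (fun ω : ↥Ω => y' (t * ω)) ∈ H := by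
  classical
  induction T using Finset.induction_on with
  | empty => exact ⟨y, rfl, by simp⟩
  | insert t T ht ih =>
    obtain ⟨y', hy', hmem⟩ := ih fun a ha b hb =>
      hT a (Finset.mem_insert_of_mem ha) b (Finset.mem_insert_of_mem hb)
    let x : G → Pt K V := fun h => y' (t * h)
    have hx : τ x ∈ τ '' cyl K V Ω Set.univ fun g => x g :=
      ⟨x, ⟨Set.mem_univ _, fun _ _ => rfl⟩, rfl⟩
    rw [hH] at hx
    obtain ⟨x', ⟨hx'H, hx'⟩, hτ⟩ := hx
    refine ⟨fun g => x' (t⁻¹ * g), funext fun g => ?_, fun s hs => ?_⟩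
    · rw [hca.translate, hτ, hca.translate, mul_inv_cancel_left, hy']
    · rcases Finset.mem_insert.1 hs with rfl | hs'
      · simpa only [inv_mul_cancel_left] using hx'H
      · convert hmem s hs' using 2 with ω
        have hout : t⁻¹ * (s * ω) ∉ Ω := fun hin => ht <|
          hT t (Finset.mem_insert_self _ _) s hs _ hin ω ω.2 (mul_inv_cancel_left _ _) ▸ hs'
        exact (hx' _ hout).trans (congrArg y' (mul_inv_cancel_left _ _))

lemma card_mul_rkPt_add_card_le [IsAlgClosed K] (hft : LocallyOfFiniteType V.hom)
    (hqc : QuasiCompact V.hom) [IrreducibleSpace V.left] {τ : (G → Pt K V) → (G → Pt K V)}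
    {M : Finset G} {f : pow K V ↥M ⟶ V}
    (hf : ∀ (x : G → Pt K V) (g : G), τ x g = ptPow K V ↥M (fun m => x (g * (m : G))) ≫ f)
    (hsurj : Function.Surjective τ) {Ω : Finset G} {H : Set (↥Ω → Pt K V)}
    (hcl : cfgClosed K V ↥Ω H) (hne : H ≠ Set.univ)
    (hH : ∀ p : {g : G // g ∉ Ω} → Pt K V, τ '' cyl K V Ω Set.univ p = τ '' cyl K V Ω H p)
    {F T E : Finset G}
    (hT : ∀ t ∈ T, ∀ t' ∈ T, ∀ ω ∈ Ω, ∀ ω' ∈ Ω, t * ω = t' * ω' → t = t')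
    (hFE : ∀ g ∈ F, ∀ m ∈ M, g * m ∈ E) (hTE : ∀ t ∈ T, ∀ ω ∈ Ω, t * ω ∈ E) :
    F.card * rkPt V (genericPoint V.left) + T.card ≤
      E.card * rkPt V (genericPoint V.left) := by
  have := locallyOfFiniteType_pow V hft
  have := quasiCompact_pow V hqc
  obtain ⟨H', hH'cl, rfl⟩ := isClosed_induced_iff.1 hcl
  have hH'ne : H' ≠ Set.univ := by
    rintro rfl
    exact hne Set.preimage_univ
  let j : ↥T → ↥Ω → ↥E := fun t ω => ⟨t * ω, hTE t t.2 ω ω.2⟩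
  have hj : Function.Injective (Function.uncurry j) := by
    rintro ⟨t, ω⟩ ⟨t', ω'⟩ h
    have h' : (t : G) * ω = t' * ω' := congrArg Subtype.val h
    obtain rfl : t = t' := Subtype.ext (hT t t.2 t' t'.2 ω ω.2 ω' ω'.2 h')
    rw [Subtype.ext (mul_left_cancel h')]
  let k : ↥F → ↥M → ↥E := fun g m => ⟨g * m, hFE g g.2 m m.2⟩
  let θ : pow K V ↥E ⟶ pow K V ↥F := powLift V fun g => reindex V (k g) ≫ f
  let Z : Set (pow K V ↥E).left := ⋂ t, (reindex V (j t)).left.base ⁻¹' H'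
  have hZ : IsClosed Z :=
    isClosed_iInter fun t => hH'cl.preimage (reindex V (j t)).left.continuous
  have hθ : ∀ y : G → Pt K V, ptPow K V ↥E (fun e => y e) ≫ θ = ptPow K V ↥F fun g => τ y g := by
    intro y
    refine pow_hom_ext fun g => ?_
    rw [Category.assoc, powLift_coord, ← Category.assoc, ptPow_reindex, ptPow_coord, hf]
    rfl
  have himg : θ.left.base '' Z = Set.univ := by
    refine image_eq_univ_of_forall_ev_mem θ hZ fun a => ?_
    obtain ⟨u, rfl⟩ := exists_ptPow_eq a
    classical
    obtain ⟨a₀, -⟩ := exists_ev_mem V isOpen_univ.isLocallyClosed Set.univ_nonempty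
    obtain ⟨y₀, hy₀⟩ := hsurj fun g => if h : g ∈ F then u ⟨g, h⟩ else a₀
    obtain ⟨y, hy, hmem⟩ := exists_tiles_mem ⟨M, f, hf⟩ hH y₀ T hT
    have hu : (fun g : ↥F => τ y g) = u := by
      funext g
      rw [hy, hy₀]
      simp
    refine ⟨ev K (ptPow K V ↥E fun e => y e), Set.mem_iInter.2 fun t => ?_, ?_⟩
    · have h : ev K (ptPow K V ↥E (fun e => y e) ≫ reindex V (j t)) ∈ H' := by
        rw [ptPow_reindex]
        exact hmem t t.2
      exact h
    · rw [← hu, ← hθ]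
      rfl
  obtain ⟨ζ, hζ⟩ := exists_rkPt_pow_ge V (genericPoint V.left) ↥F
  obtain ⟨z, hz, rfl⟩ : ζ ∈ θ.left.base '' Z := himg ▸ Set.mem_univ ζ
  have key := rkPt_add_card_le V j hj hH'cl hH'ne z (Set.mem_iInter.1 hz)
  rw [ENat.card_eq_coe_natCard] at hζ
  simp only [Nat.card_eq_fintype_card, Fintype.card_coe] at hζ key
  exact (add_le_add_left (hζ.trans (rkPt_map_le θ z)) _).trans key

end CellularAutomata

/-- Theorem 1.3, Moore-type direction. Let `G` be an amenable group
and `X` an irreducible algebraic variety over an algebraically closed field `K`, with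
`A := X(K)`. Then every surjective algebraic cellular automaton over `(G,X,K)` is
`(*)`-pre-injective. -/
theorem surjective_implies_starPreInjective
    (G : Type) [Group G] (hG : Amenable G)
    (K : Type) [Field K] [IsAlgClosed K]
    (V : Over (SpecK K)) (hft : LocallyOfFiniteType V.hom) (hqc : QuasiCompact V.hom)
    (hirr : IrreducibleSpace V.left)
    (τ : (G → Pt K V) → (G → Pt K V)) (hca : IsAlgCA K V τ)
    (hsurj : Function.Surjective τ) :
    StarPreInjective K V τ := by
  classical
  open scoped Pointwise in
  rintro ⟨Ω, H, hcl, hne, hH⟩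
  obtain ⟨𝓕⟩ := hG
  obtain ⟨M, f, hf⟩ := hca
  obtain ⟨d, hd⟩ := ENat.ne_top_iff_exists.1 (rkPt_lt_top V (genericPoint V.left)).ne
  let c : ℕ := (insert 1 (Ω * Ω⁻¹)).card * d
  let b : G → 𝓕.ι → ℕ := fun n i =>
    ((𝓕.F i : Set G) \ ((· * n⁻¹) '' (𝓕.F i : Set G))).ncard
  have key : ∀ i, (𝓕.F i).card ≤ c * ∑ n ∈ M ∪ Ω, b n i := by
    intro i
    obtain ⟨T, hTF, hT, hcard⟩ := exists_disjoint_translates (𝓕.F i) Ω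
    have h := card_mul_rkPt_add_card_le hft hqc hf hsurj hcl hne hH
      (F := 𝓕.F i) (E := 𝓕.F i ∪ 𝓕.F i * (M ∪ Ω)) hT
      (fun g hg m hm => Finset.mem_union_right _
        (Finset.mul_mem_mul hg (Finset.mem_union_left _ hm)))
      (fun t ht ω hω => Finset.mem_union_right _
        (Finset.mul_mem_mul (hTF ht) (Finset.mem_union_right _ hω)))
    rw [← hd] at h
    have h' : (𝓕.F i).card * d + T.card ≤ (𝓕.F i ∪ 𝓕.F i * (M ∪ Ω)).card * d := by
      exact_mod_cast h
    have hE : (𝓕.F i ∪ 𝓕.F i * (M ∪ Ω)).card * d ≤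
        ((𝓕.F i).card + ∑ n ∈ M ∪ Ω, b n i) * d :=
      Nat.mul_le_mul_right d (card_mul_le_add_sum (𝓕.F i) (M ∪ Ω))
    rw [add_mul] at hE
    have hTd : T.card ≤ (∑ n ∈ M ∪ Ω, b n i) * d := by omega
    calc (𝓕.F i).card ≤ T.card * (insert 1 (Ω * Ω⁻¹)).card := hcard
      _ ≤ ((∑ n ∈ M ∪ Ω, b n i) * d) * (insert 1 (Ω * Ω⁻¹)).card := Nat.mul_le_mul_right _ hTd
      _ = c * ∑ n ∈ M ∪ Ω, b n i := by ring
  have hlim : Tendsto (fun i => (c : ℝ) * ∑ n ∈ M ∪ Ω, (b n i : ℝ) / (𝓕.F i).card) atTop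
      (𝓝 ((c : ℝ) * ∑ n ∈ M ∪ Ω, 0)) :=
    (tendsto_finsetSum _ fun n _ => 𝓕.folner n⁻¹).const_mul _
  rw [Finset.sum_const_zero, mul_zero] at hlim
  refine absurd (ge_of_tendsto' hlim fun i => ?_) (not_le.2 zero_lt_one)
  have hpos : (0 : ℝ) < (𝓕.F i).card := by exact_mod_cast (𝓕.nonempty i).card_pos
  rw [← Finset.sum_div, ← mul_div_assoc, le_div_iff₀ hpos, one_mul]
  exact_mod_cast key i

end GOE
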